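/- Let (H,A) be a compatible weak matched pair. For x ∈ A, h ∈ H write x♯♯h := (id⊗ε)Δ(x♯h). Then Δ(x♯♯h) = (x₁♯♯(h₁)⁰) ⊗ ((x₂(h₁)¹)♯♯h₂), an element of (A♯♯H)⊗(A♯♯H), where A♯♯H := (id⊗ε)Δ(A♯H). -/

import Mathlib

open TensorProduct

noncomputable section

namespace WeakSmash

variable (k : Type*) [Field k]

/-- A weak bialgebra structure on the `k`-algebra `H`. -/
structure WeakBialgebra (H : Type*) [Ring H] [Algebra k H] where
  comul : H →ₗ[k] H ⊗[k] H
  counit : H →ₗ[k] k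
  coassoc : ∀ h : H,
    (TensorProduct.assoc k H H H) ((LinearMap.rTensor H comul) (comul h)) =
      (LinearMap.lTensor H comul) (comul h)
  counit_comul : ∀ h : H,
    (TensorProduct.lid k H) ((LinearMap.rTensor H counit) (comul h)) = h
  comul_counit : ∀ h : H,
    (TensorProduct.rid k H) ((LinearMap.lTensor H counit) (comul h)) = h
  comul_mul : ∀ h g : H, comul (h * g) = comul h * comul g
  counit_weak : ∀ h g l : H,
    counit (h * g * l) =
      LinearMap.mul' k k
        ((TensorProduct.map (counit ∘ₗ LinearMap.mulLeft k h)
            (counit ∘ₗ LinearMap.mulRight k l)) (comul g))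
  counit_weak' : ∀ h g l : H,
    counit (h * g * l) =
      LinearMap.mul' k k
        ((TensorProduct.map (counit ∘ₗ LinearMap.mulLeft k h)
            (counit ∘ₗ LinearMap.mulRight k l)) ((TensorProduct.comm k H H) (comul g)))
  comul_one_left :
    ((TensorProduct.assoc k H H H) (comul 1 ⊗ₜ[k] (1 : H))) * ((1 : H) ⊗ₜ[k] comul 1) =
      (LinearMap.lTensor H comul) (comul 1)
  comul_one_right :
    ((1 : H) ⊗ₜ[k] comul 1) * ((TensorProduct.assoc k H H H) (comul 1 ⊗ₜ[k] (1 : H))) =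
      (LinearMap.lTensor H comul) (comul 1)

variable {k}

namespace WeakBialgebra

variable {H : Type*} [Ring H] [Algebra k H]

/-- The target counital map `εt h = ε(1₁ h) 1₂`. -/
def εt (W : WeakBialgebra k H) : H →ₗ[k] H :=
  (TensorProduct.lid k H).toLinearMap ∘ₗ LinearMap.rTensor H W.counit ∘ₗ
    LinearMap.mulLeft k (W.comul 1) ∘ₗ (TensorProduct.mk k H H).flip 1

/-- The source counital map `εs h = 1₁ ε(h 1₂)`. -/
def εs (W : WeakBialgebra k H) : H →ₗ[k] H :=
  (TensorProduct.rid k H).toLinearMap ∘ₗ LinearMap.lTensor H W.counit ∘ₗ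
    LinearMap.mulRight k (W.comul 1) ∘ₗ TensorProduct.mk k H H 1

/-- Cocommutativity of a weak bialgebra. -/
def Cocomm (W : WeakBialgebra k H) : Prop :=
  ∀ h : H, (TensorProduct.comm k H H) (W.comul h) = W.comul h

/-- `S` is an antipode for `W`, making it a weak Hopf algebra. -/
structure IsAntipode (W : WeakBialgebra k H) (S : H →ₗ[k] H) : Prop where
  mul_antipode : ∀ h : H,
    LinearMap.mul' k H ((LinearMap.lTensor H S) (W.comul h)) = W.εt h
  antipode_mul : ∀ h : H,
    LinearMap.mul' k H ((LinearMap.rTensor H S) (W.comul h)) = W.εs h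
  antipode_mid : ∀ h : H,
    LinearMap.mul' k H
      ((TensorProduct.map S (LinearMap.mul' k H ∘ₗ LinearMap.lTensor H S))
        ((LinearMap.lTensor H W.comul) (W.comul h))) = S h

/-- `α` is a left integral: `h α = εt(h) α`. -/
def IsLeftIntegral (W : WeakBialgebra k H) (α : H) : Prop :=
  ∀ h : H, h * α = W.εt h * α

end WeakBialgebra

section MatchedPair

variable (k)
variable {H A : Type*} [Ring H] [Algebra k H] [Ring A] [Algebra k A]

/-- `A` is a left `H`-module algebra via the action `act`. -/
structure IsModuleAlgebra (WH : WeakBialgebra k H) (act : H →ₗ[k] A →ₗ[k] A) : Prop where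
  one_act : ∀ a : A, act 1 a = a
  act_mul : ∀ (h : H) (a b : A),
    act h (a * b) =
      LinearMap.mul' k A ((TensorProduct.map (act.flip a) (act.flip b)) (WH.comul h))
  act_act : ∀ (h g : H) (a : A), act h (act g a) = act (h * g) a
  act_unit : ∀ h : H, act h 1 = act (WH.εt h) 1

/-- The map `h ↦ ε(h⁰) h¹`. -/
def coactCounit (WH : WeakBialgebra k H) (coact : H →ₗ[k] H ⊗[k] A) : H →ₗ[k] A :=
  (TensorProduct.lid k A).toLinearMap ∘ₗ LinearMap.rTensor A WH.counit ∘ₗ coact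

/-- `H` is a right `A`-comodule coalgebra via the coaction `coact`. -/
structure IsComoduleCoalgebra (WH : WeakBialgebra k H) (WA : WeakBialgebra k A)
    (coact : H →ₗ[k] H ⊗[k] A) : Prop where
  counit_coact : ∀ h : H,
    (TensorProduct.rid k H) ((LinearMap.lTensor H WA.counit) (coact h)) = h
  comul_coact : ∀ h : H,
    (LinearMap.rTensor A WH.comul) (coact h) =
      (LinearMap.lTensor (H ⊗[k] H) (LinearMap.mul' k A))
        ((TensorProduct.tensorTensorTensorComm k H A H A)
          ((TensorProduct.map coact coact) (WH.comul h)))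
  coact_coact : ∀ h : H,
    (TensorProduct.assoc k H A A) ((LinearMap.rTensor A coact) (coact h)) =
      (LinearMap.lTensor H WA.comul) (coact h)
  coact_counit : ∀ h : H,
    coactCounit k WH coact h = WA.εs (coactCounit k WH coact h)

/-- The map `(h₁ ⊗ h₂) ⊗ (x₁ ⊗ x₂) ↦ (h₁⁰ · x₁) ⊗ (h₁¹ (h₂ · x₂))`. -/
def pairMapA (act : H →ₗ[k] A →ₗ[k] A) (coact : H →ₗ[k] H ⊗[k] A) :
    (H ⊗[k] H) ⊗[k] (A ⊗[k] A) →ₗ[k] A ⊗[k] A :=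
  LinearMap.lTensor A (LinearMap.mul' k A) ∘ₗ
  (TensorProduct.assoc k A A A).toLinearMap ∘ₗ
  LinearMap.rTensor A
    (LinearMap.rTensor A (TensorProduct.lift act) ∘ₗ
      (TensorProduct.assoc k H A A).symm.toLinearMap ∘ₗ
      LinearMap.lTensor H (TensorProduct.comm k A A).toLinearMap ∘ₗ
      (TensorProduct.assoc k H A A).toLinearMap) ∘ₗ
  TensorProduct.map (LinearMap.rTensor A coact) (TensorProduct.lift act) ∘ₗ
  (TensorProduct.tensorTensorTensorComm k H H A A).toLinearMap

/-- The map `(h₁ ⊗ h₂) ⊗ (g⁰ ⊗ g¹) ↦ (h₁⁰ g⁰) ⊗ (h₁¹ (h₂ · g¹))`. -/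
def pairMapH (act : H →ₗ[k] A →ₗ[k] A) (coact : H →ₗ[k] H ⊗[k] A) :
    (H ⊗[k] H) ⊗[k] (H ⊗[k] A) →ₗ[k] H ⊗[k] A :=
  LinearMap.lTensor H (LinearMap.mul' k A) ∘ₗ
  (TensorProduct.assoc k H A A).toLinearMap ∘ₗ
  LinearMap.rTensor A
    (LinearMap.rTensor A (LinearMap.mul' k H) ∘ₗ
      (TensorProduct.assoc k H H A).symm.toLinearMap ∘ₗ
      LinearMap.lTensor H (TensorProduct.comm k A H).toLinearMap ∘ₗ
      (TensorProduct.assoc k H A H).toLinearMap) ∘ₗ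
  TensorProduct.map (LinearMap.rTensor H coact) (TensorProduct.lift act) ∘ₗ
  (TensorProduct.tensorTensorTensorComm k H H H A).toLinearMap

/-- The iterated comultiplication `h ↦ h₁ ⊗ (h₂ ⊗ h₃)`. -/
def twoComul (WH : WeakBialgebra k H) : H →ₗ[k] H ⊗[k] (H ⊗[k] H) :=
  LinearMap.lTensor H WH.comul ∘ₗ WH.comul

/-- The iterated comultiplication `h ↦ h₁ ⊗ (h₂ ⊗ (h₃ ⊗ h₄))`. -/
def threeComul (WH : WeakBialgebra k H) : H →ₗ[k] H ⊗[k] (H ⊗[k] (H ⊗[k] H)) :=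
  LinearMap.lTensor H (LinearMap.lTensor H WH.comul) ∘ₗ LinearMap.lTensor H WH.comul ∘ₗ WH.comul

/-- Left-hand side of the matched pair condition (iii):
`(h₁·x)₁ ⊗ (h₂ g)⁰ ⊗ (h₁·x)₂ (h₂ g)¹`. -/
def mpLHS (WH : WeakBialgebra k H) (WA : WeakBialgebra k A)
    (act : H →ₗ[k] A →ₗ[k] A) (coact : H →ₗ[k] H ⊗[k] A) (h g : H) (x : A) :
    (A ⊗[k] H) ⊗[k] A :=
  LinearMap.lTensor (A ⊗[k] H) (LinearMap.mul' k A)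
    ((TensorProduct.tensorTensorTensorComm k A A H A)
      ((TensorProduct.map (WA.comul ∘ₗ act.flip x) (coact ∘ₗ LinearMap.mulRight k g))
        (WH.comul h)))

/-- Right-hand side of the matched pair condition (iii):
`(h₁⁰ · x₁) ⊗ (h₃⁰ g⁰) ⊗ (h₁¹ (h₂ · x₂) h₃¹ (h₄ · g¹))`. -/
def mpRHS (WH : WeakBialgebra k H) (WA : WeakBialgebra k A)
    (act : H →ₗ[k] A →ₗ[k] A) (coact : H →ₗ[k] H ⊗[k] A) (h g : H) (x : A) :
    (A ⊗[k] H) ⊗[k] A :=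
  LinearMap.lTensor (A ⊗[k] H) (LinearMap.mul' k A)
    ((TensorProduct.tensorTensorTensorComm k A A H A)
      ((TensorProduct.map
          (pairMapA k act coact ∘ₗ
            (TensorProduct.mk k (H ⊗[k] H) (A ⊗[k] A)).flip (WA.comul x))
          (pairMapH k act coact ∘ₗ
            (TensorProduct.mk k (H ⊗[k] H) (H ⊗[k] A)).flip (coact g)))
        ((TensorProduct.assoc k H H (H ⊗[k] H)).symm (threeComul k WH h))))

/-- `(H, A)` is a weak matched pair. -/
structure IsWeakMatchedPair (WH : WeakBialgebra k H) (WA : WeakBialgebra k A)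
    (act : H →ₗ[k] A →ₗ[k] A) (coact : H →ₗ[k] H ⊗[k] A) : Prop where
  moduleAlgebra : IsModuleAlgebra k WH act
  comoduleCoalgebra : IsComoduleCoalgebra k WH WA coact
  cond3 : ∀ (h g : H) (x : A),
    mpLHS k WH WA act coact h g x = mpRHS k WH WA act coact h g x
  cond4 : ∀ (h : H) (x : A), WA.εs (act h x) = WA.εs (act h 1) * WA.εs x
  cond5 :
    (LinearMap.rTensor H coact) (WH.comul 1) =
      (TensorProduct.map (LinearMap.lTensor H (coactCounit k WH coact))
          (LinearMap.mul' k H))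
        ((TensorProduct.tensorTensorTensorComm k H H H H)
          (WH.comul 1 ⊗ₜ[k] WH.comul 1))

/-- `(H, A)` is a compatible (abelian) weak matched pair. -/
structure IsCompatiblePair (WH : WeakBialgebra k H) (WA : WeakBialgebra k A)
    (act : H →ₗ[k] A →ₗ[k] A) (coact : H →ₗ[k] H ⊗[k] A) : Prop where
  pair : IsWeakMatchedPair k WH WA act coact
  cocomm : WH.Cocomm
  comm : ∀ a b : A, a * b = b * a
  compat1 : ∀ h : H,
    act h 1 =
      (TensorProduct.rid k A)
        ((TensorProduct.map (TensorProduct.lift act)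
            (WA.counit ∘ₗ TensorProduct.lift act))
          ((TensorProduct.tensorTensorTensorComm k H H A A)
            (WH.comul h ⊗ₜ[k] WA.comul 1)))
  compat2 : ∀ h g : H,
    (TensorProduct.map (act h) (act g)) (WA.comul 1) =
      (TensorProduct.map (LinearMap.mulLeft k (act h 1))
        (LinearMap.mulLeft k (act g 1))) (WA.comul 1)

/-- The smash product multiplication on `A ⊗ H`:
`(x ⊗ h) (y ⊗ g) = x (h₁ · y) ⊗ h₂ g`. -/
def smashMul (WH : WeakBialgebra k H) (act : H →ₗ[k] A →ₗ[k] A) :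
    (A ⊗[k] H) ⊗[k] (A ⊗[k] H) →ₗ[k] A ⊗[k] H :=
  LinearMap.rTensor H (LinearMap.mul' k A) ∘ₗ
  (TensorProduct.assoc k A A H).symm.toLinearMap ∘ₗ
  LinearMap.lTensor A
    (TensorProduct.map (TensorProduct.lift act) (LinearMap.mul' k H) ∘ₗ
      (TensorProduct.tensorTensorTensorComm k H H A H).toLinearMap) ∘ₗ
  (TensorProduct.assoc k A (H ⊗[k] H) (A ⊗[k] H)).toLinearMap ∘ₗ
  LinearMap.rTensor (A ⊗[k] H) (LinearMap.lTensor A WH.comul)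

/-- The smash coproduct on `A ⊗ H`:
`Δ(x ⊗ h) = (x₁ ⊗ h₁⁰) ⊗ (x₂ h₁¹ ⊗ h₂)`. -/
def smashComul (WH : WeakBialgebra k H) (WA : WeakBialgebra k A)
    (coact : H →ₗ[k] H ⊗[k] A) :
    A ⊗[k] H →ₗ[k] (A ⊗[k] H) ⊗[k] (A ⊗[k] H) :=
  (TensorProduct.assoc k (A ⊗[k] H) A H).toLinearMap ∘ₗ
  LinearMap.rTensor H (LinearMap.lTensor (A ⊗[k] H) (LinearMap.mul' k A)) ∘ₗ
  LinearMap.rTensor H (TensorProduct.tensorTensorTensorComm k A A H A).toLinearMap ∘ₗ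
  (TensorProduct.assoc k (A ⊗[k] A) (H ⊗[k] A) H).symm.toLinearMap ∘ₗ
  LinearMap.lTensor (A ⊗[k] A) (LinearMap.rTensor H coact) ∘ₗ
  TensorProduct.map WA.comul WH.comul

/-- The smash counit `ε(x ⊗ h) = ε(x) ε(h)`. -/
def smashCounit (WH : WeakBialgebra k H) (WA : WeakBialgebra k A) :
    A ⊗[k] H →ₗ[k] k :=
  LinearMap.mul' k k ∘ₗ TensorProduct.map WA.counit WH.counit

/-- The projection `u ↦ u (1_A # 1_H)` onto `A ♯ H`. -/
def projUnder (WH : WeakBialgebra k H) (act : H →ₗ[k] A →ₗ[k] A) :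
    A ⊗[k] H →ₗ[k] A ⊗[k] H :=
  smashMul k WH act ∘ₗ
    (TensorProduct.mk k (A ⊗[k] H) (A ⊗[k] H)).flip ((1 : A) ⊗ₜ[k] (1 : H))

/-- The projection `u ↦ (id ⊗ ε) Δ(u)` onto `overline(A # H)`. -/
def projBar (WH : WeakBialgebra k H) (WA : WeakBialgebra k A)
    (coact : H →ₗ[k] H ⊗[k] A) : A ⊗[k] H →ₗ[k] A ⊗[k] H :=
  (TensorProduct.rid k (A ⊗[k] H)).toLinearMap ∘ₗ
    LinearMap.lTensor (A ⊗[k] H) (smashCounit k WH WA) ∘ₗ smashComul k WH WA coact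

/-- The projection onto `A ♯♯ H`, i.e. `u ↦ (id ⊗ ε) Δ (u (1#1))`. -/
def projBoth (WH : WeakBialgebra k H) (WA : WeakBialgebra k A)
    (act : H →ₗ[k] A →ₗ[k] A) (coact : H →ₗ[k] H ⊗[k] A) :
    A ⊗[k] H →ₗ[k] A ⊗[k] H :=
  projBar k WH WA coact ∘ₗ projUnder k WH act

/-- Componentwise smash multiplication on `(A⊗H) ⊗ (A⊗H)`. -/
def smashMul2 (WH : WeakBialgebra k H) (act : H →ₗ[k] A →ₗ[k] A) :
    ((A ⊗[k] H) ⊗[k] (A ⊗[k] H)) ⊗[k] ((A ⊗[k] H) ⊗[k] (A ⊗[k] H)) →ₗ[k]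
      (A ⊗[k] H) ⊗[k] (A ⊗[k] H) :=
  TensorProduct.map (smashMul k WH act) (smashMul k WH act) ∘ₗ
    (TensorProduct.tensorTensorTensorComm k (A ⊗[k] H) (A ⊗[k] H)
      (A ⊗[k] H) (A ⊗[k] H)).toLinearMap

/-- Componentwise smash multiplication on threefold tensors. -/
def smashMul3 (WH : WeakBialgebra k H) (act : H →ₗ[k] A →ₗ[k] A) :
    ((A ⊗[k] H) ⊗[k] ((A ⊗[k] H) ⊗[k] (A ⊗[k] H))) ⊗[k]
      ((A ⊗[k] H) ⊗[k] ((A ⊗[k] H) ⊗[k] (A ⊗[k] H))) →ₗ[k]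
      (A ⊗[k] H) ⊗[k] ((A ⊗[k] H) ⊗[k] (A ⊗[k] H)) :=
  TensorProduct.map (smashMul k WH act) (smashMul2 k WH act) ∘ₗ
    (TensorProduct.tensorTensorTensorComm k (A ⊗[k] H)
      ((A ⊗[k] H) ⊗[k] (A ⊗[k] H)) (A ⊗[k] H)
      ((A ⊗[k] H) ⊗[k] (A ⊗[k] H))).toLinearMap

/-- The unit element `1_A ♯♯ 1_H` of `A ♯♯ H`. -/
def smashOne (WH : WeakBialgebra k H) (WA : WeakBialgebra k A)
    (act : H →ₗ[k] A →ₗ[k] A) (coact : H →ₗ[k] H ⊗[k] A) : A ⊗[k] H :=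
  projBoth k WH WA act coact ((1 : A) ⊗ₜ[k] (1 : H))

/-- The map `εt` of the weak bialgebra `A ♯♯ H`: `u ↦ ε(e₁ u) e₂` where `e = 1_A ♯♯ 1_H`. -/
def smashEpsT (WH : WeakBialgebra k H) (WA : WeakBialgebra k A)
    (act : H →ₗ[k] A →ₗ[k] A) (coact : H →ₗ[k] H ⊗[k] A) (u : A ⊗[k] H) :
    A ⊗[k] H :=
  (TensorProduct.lid k (A ⊗[k] H))
    ((LinearMap.rTensor (A ⊗[k] H)
        (smashCounit k WH WA ∘ₗ smashMul k WH act ∘ₗ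
          (TensorProduct.mk k (A ⊗[k] H) (A ⊗[k] H)).flip u))
      (smashComul k WH WA coact (smashOne k WH WA act coact)))

/-- The map `εs` of the weak bialgebra `A ♯♯ H`: `u ↦ e₁ ε(u e₂)` where `e = 1_A ♯♯ 1_H`. -/
def smashEpsS (WH : WeakBialgebra k H) (WA : WeakBialgebra k A)
    (act : H →ₗ[k] A →ₗ[k] A) (coact : H →ₗ[k] H ⊗[k] A) (u : A ⊗[k] H) :
    A ⊗[k] H :=
  (TensorProduct.rid k (A ⊗[k] H))
    ((LinearMap.lTensor (A ⊗[k] H)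
        (smashCounit k WH WA ∘ₗ smashMul k WH act ∘ₗ
          TensorProduct.mk k (A ⊗[k] H) (A ⊗[k] H) u))
      (smashComul k WH WA coact (smashOne k WH WA act coact)))

/-- The antipode of `A ♯♯ H`:
`S(x ⊗ h) = (1_A ♯♯ S_H(h⁰)) ((S_A(x h¹)) ♯♯ 1_H)`. -/
def smashAntipode (WH : WeakBialgebra k H) (WA : WeakBialgebra k A)
    (act : H →ₗ[k] A →ₗ[k] A) (coact : H →ₗ[k] H ⊗[k] A)
    (SH : H →ₗ[k] H) (SA : A →ₗ[k] A) : A ⊗[k] H →ₗ[k] A ⊗[k] H :=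
  smashMul k WH act ∘ₗ
  TensorProduct.map
    (projBoth k WH WA act coact ∘ₗ TensorProduct.mk k A H 1)
    (projBoth k WH WA act coact ∘ₗ (TensorProduct.mk k A H).flip 1) ∘ₗ
  (TensorProduct.comm k A H).toLinearMap ∘ₗ
  TensorProduct.map (SA ∘ₗ LinearMap.mul' k A) SH ∘ₗ
  (TensorProduct.assoc k A A H).symm.toLinearMap ∘ₗ
  LinearMap.lTensor A ((TensorProduct.comm k H A).toLinearMap ∘ₗ coact)

/-- LHS of condition (7): `(1_{H1} h⁰ · 1_A) ⊗ S_A(h¹) εs(1_{H2}¹) ⊗ 1_{H2}⁰`. -/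
def cond7LHS (WH : WeakBialgebra k H) (WA : WeakBialgebra k A)
    (act : H →ₗ[k] A →ₗ[k] A) (coact : H →ₗ[k] H ⊗[k] A)
    (SA : A →ₗ[k] A) (h : H) : (A ⊗[k] A) ⊗[k] H :=
  (TensorProduct.assoc k A A H).symm
    ((TensorProduct.map
        (act.flip 1 ∘ₗ LinearMap.mul' k H)
        ((TensorProduct.comm k H A).toLinearMap ∘ₗ
          LinearMap.lTensor H
            (LinearMap.mul' k A ∘ₗ TensorProduct.map SA WA.εs ∘ₗ
              (TensorProduct.comm k A A).toLinearMap) ∘ₗ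
          (TensorProduct.assoc k H A A).toLinearMap ∘ₗ
          LinearMap.rTensor A coact))
      ((TensorProduct.tensorTensorTensorComm k H H H A)
        (WH.comul 1 ⊗ₜ[k] coact h)))

/-- RHS of condition (7):
`εt(1_{H1}⁰ h⁰ · 1_A) ⊗ εt(h¹) εs(1_{H2}¹) 1_{H1}¹ ⊗ 1_{H2}⁰`. -/
def cond7RHS (WH : WeakBialgebra k H) (WA : WeakBialgebra k A)
    (act : H →ₗ[k] A →ₗ[k] A) (coact : H →ₗ[k] H ⊗[k] A) (h : H) :
    (A ⊗[k] A) ⊗[k] H :=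
  (TensorProduct.assoc k A A H).symm
   ((LinearMap.lTensor A (TensorProduct.comm k H A).toLinearMap)
    ((TensorProduct.assoc k A H A)
     ((LinearMap.lTensor (A ⊗[k] H)
        (LinearMap.mul' k A ∘ₗ (TensorProduct.comm k A A).toLinearMap))
      ((TensorProduct.tensorTensorTensorComm k A A H A)
       ((LinearMap.lTensor (A ⊗[k] A) (TensorProduct.comm k A H).toLinearMap)
        ((TensorProduct.map
            (LinearMap.rTensor A (WA.εt ∘ₗ act.flip 1 ∘ₗ LinearMap.mul' k H) ∘ₗ
              (TensorProduct.assoc k H H A).symm.toLinearMap ∘ₗ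
              LinearMap.lTensor H (TensorProduct.comm k A H).toLinearMap ∘ₗ
              (TensorProduct.assoc k H A H).toLinearMap)
            (LinearMap.rTensor H
                (LinearMap.mul' k A ∘ₗ (TensorProduct.comm k A A).toLinearMap ∘ₗ
                  TensorProduct.map WA.εs WA.εt) ∘ₗ
              (TensorProduct.assoc k A A H).symm.toLinearMap ∘ₗ
              LinearMap.lTensor A (TensorProduct.comm k H A).toLinearMap ∘ₗ
              (TensorProduct.assoc k A H A).toLinearMap ∘ₗ
              LinearMap.rTensor A (TensorProduct.comm k H A).toLinearMap))
          ((TensorProduct.tensorTensorTensorComm k (H ⊗[k] A) (H ⊗[k] A) H A)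
            (((TensorProduct.map coact coact) (WH.comul 1)) ⊗ₜ[k] coact h))))))))

/-- LHS of condition (8):
`εs(h₁¹ h₂¹) (S_H(h₁⁰) · 1_A) ⊗ S_H(h₂⁰) h₃`. -/
def cond8LHS (WH : WeakBialgebra k H) (WA : WeakBialgebra k A)
    (act : H →ₗ[k] A →ₗ[k] A) (coact : H →ₗ[k] H ⊗[k] A)
    (SH : H →ₗ[k] H) (h : H) : A ⊗[k] H :=
  LinearMap.rTensor H (LinearMap.mul' k A)
   ((TensorProduct.assoc k A A H).symm
    ((TensorProduct.map
        (WA.εs ∘ₗ LinearMap.mul' k A)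
        (TensorProduct.map (act.flip 1 ∘ₗ SH)
          (LinearMap.mul' k H ∘ₗ LinearMap.rTensor H SH)))
      ((TensorProduct.tensorTensorTensorComm k A H A (H ⊗[k] H))
        ((TensorProduct.map (TensorProduct.comm k H A).toLinearMap
            ((TensorProduct.assoc k A H H).toLinearMap ∘ₗ
              LinearMap.rTensor H (TensorProduct.comm k H A).toLinearMap))
          ((TensorProduct.map coact (LinearMap.rTensor H coact))
            (twoComul k WH h))))))

/-- RHS of condition (8):
`εs(h¹ 1_{H2}¹) εs(h⁰ 1_{H1} · 1_A) ⊗ 1_{H2}⁰`. -/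
def cond8RHS (WH : WeakBialgebra k H) (WA : WeakBialgebra k A)
    (act : H →ₗ[k] A →ₗ[k] A) (coact : H →ₗ[k] H ⊗[k] A) (h : H) :
    A ⊗[k] H :=
  LinearMap.rTensor H (LinearMap.mul' k A ∘ₗ (TensorProduct.comm k A A).toLinearMap)
   ((TensorProduct.assoc k A A H).symm
    ((TensorProduct.map
        (WA.εs ∘ₗ act.flip 1 ∘ₗ LinearMap.mul' k H)
        (LinearMap.rTensor H (WA.εs ∘ₗ LinearMap.mul' k A) ∘ₗ
          (TensorProduct.assoc k A A H).symm.toLinearMap ∘ₗ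
          LinearMap.lTensor A (TensorProduct.comm k H A).toLinearMap))
      ((TensorProduct.tensorTensorTensorComm k H A H (H ⊗[k] A))
        (coact h ⊗ₜ[k] (LinearMap.lTensor H coact) (WH.comul 1)))))

/-- The element `εs(t₁¹ (t₂ · 1_A)) ⊗ t₁⁰` of `A ⊗ H`. -/
def integralWitness (WH : WeakBialgebra k H) (WA : WeakBialgebra k A)
    (act : H →ₗ[k] A →ₗ[k] A) (coact : H →ₗ[k] H ⊗[k] A) (t : H) :
    A ⊗[k] H :=
  (TensorProduct.comm k H A)
    ((LinearMap.lTensor H (WA.εs ∘ₗ LinearMap.mul' k A))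
      ((TensorProduct.assoc k H A A)
        ((LinearMap.rTensor A coact)
          ((LinearMap.lTensor H (act.flip 1)) (WH.comul t)))))

end MatchedPair

end WeakSmash


namespace WeakSmash

section Aux

variable {k H A R S : Type*} [Field k] [Ring H] [Algebra k H] [Ring A] [Algebra k A]
  [Ring R] [Algebra k R] [Ring S] [Algebra k S]

namespace WeakBialgebra

/-- The convolution product `(f * g) h = f(h₁) g(h₂)`. -/
def conv (W : WeakBialgebra k H) (f g : H →ₗ[k] R) : H →ₗ[k] R :=
  LinearMap.mul' k R ∘ₗ TensorProduct.map f g ∘ₗ W.comul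

variable (W : WeakBialgebra k H)

lemma conv_apply (f g : H →ₗ[k] R) (h : H) :
    W.conv f g h = LinearMap.mul' k R (TensorProduct.map f g (W.comul h)) := rfl

lemma algHom_conv (φ : R →ₐ[k] S) (f g : H →ₗ[k] R) (h : H) :
    φ (W.conv f g h) = W.conv (φ.toLinearMap ∘ₗ f) (φ.toLinearMap ∘ₗ g) h := by
  simp only [conv_apply]
  induction W.comul h with
  | zero => simp
  | tmul a b => simp
  | add s t hs ht => simp only [map_add, hs, ht]

lemma algHom_comp_conv (φ : R →ₐ[k] S) (f g : H →ₗ[k] R) :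
    φ.toLinearMap ∘ₗ W.conv f g = W.conv (φ.toLinearMap ∘ₗ f) (φ.toLinearMap ∘ₗ g) :=
  LinearMap.ext (W.algHom_conv φ f g)

lemma conv_eq_twoComul (f g l : H →ₗ[k] R) (h : H) :
    W.conv f (W.conv g l) h =
      LinearMap.mul' k R (TensorProduct.map f (LinearMap.mul' k R ∘ₗ TensorProduct.map g l)
        (twoComul k W h)) := by
  simp only [conv_apply, twoComul, LinearMap.comp_apply]
  induction W.comul h with
  | zero => simp
  | tmul a b => simp [conv_apply]
  | add s t hs ht => simp only [map_add, hs, ht]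

lemma conv_conv_conv_apply (f g l m : H →ₗ[k] R) (h : H) :
    W.conv f (W.conv g (W.conv l m)) h =
      LinearMap.mul' k R (TensorProduct.map f (LinearMap.mul' k R ∘ₗ
        TensorProduct.map g (LinearMap.mul' k R ∘ₗ TensorProduct.map l m))
        (threeComul k W h)) := by
  rw [conv_eq_twoComul]
  change _ = LinearMap.mul' k R (TensorProduct.map f _
    (LinearMap.lTensor H (LinearMap.lTensor H W.comul) (twoComul k W h)))
  induction twoComul k W h with
  | zero => simp
  | tmul a t =>
    simp only [TensorProduct.map_tmul, LinearMap.lTensor_tmul, LinearMap.comp_apply]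
    congr 2
    induction t with
    | zero => simp
    | tmul b c => simp [conv_apply]
    | add s t hs ht => simp only [map_add, hs, ht]
  | add s t hs ht => simp only [map_add, hs, ht]

lemma conv_assoc (f g l : H →ₗ[k] R) :
    W.conv (W.conv f g) l = W.conv f (W.conv g l) := by
  ext h
  rw [conv_eq_twoComul, twoComul, LinearMap.comp_apply, ← W.coassoc, conv_apply]
  induction W.comul h with
  | zero => simp
  | tmul a b =>
    simp only [TensorProduct.map_tmul, LinearMap.rTensor_tmul, conv_apply]
    induction W.comul a with
    | zero => simp
    | tmul c d => simp [mul_assoc]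
    | add s t hs ht =>
      simp only [map_add, TensorProduct.add_tmul, hs, ht]
  | add s t hs ht => simp only [map_add, hs, ht]

lemma conv_comm (hW : W.Cocomm) (f g : H →ₗ[k] R) (hfg : ∀ a b, Commute (f a) (g b)) :
    W.conv f g = W.conv g f := by
  ext h
  rw [conv_apply, conv_apply, ← hW h]
  conv_rhs => rw [← hW h]
  induction W.comul h with
  | zero => simp
  | tmul a b => simpa using (hfg b a).eq
  | add s t hs ht => simp only [map_add, hs, ht]

lemma mul_conv (r : R) (f g : H →ₗ[k] R) :
    LinearMap.mulLeft k r ∘ₗ W.conv f g = W.conv (LinearMap.mulLeft k r ∘ₗ f) g := by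
  ext h
  simp only [LinearMap.comp_apply, conv_apply]
  induction W.comul h with
  | zero => simp
  | tmul a b => simp [mul_assoc]
  | add s t hs ht => simp only [map_add, hs, ht]

lemma conv_mul (r : R) (f g : H →ₗ[k] R) :
    LinearMap.mulRight k r ∘ₗ W.conv f g = W.conv f (LinearMap.mulRight k r ∘ₗ g) := by
  ext h
  simp only [LinearMap.comp_apply, conv_apply]
  induction W.comul h with
  | zero => simp
  | tmul a b => simp [mul_assoc]
  | add s t hs ht => simp only [map_add, hs, ht]

end WeakBialgebra

section Coaction

variable {WH : WeakBialgebra k H} {WA : WeakBialgebra k A}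
  {act : H →ₗ[k] A →ₗ[k] A} {coact : H →ₗ[k] H ⊗[k] A}

lemma coactCounit_conv_self (hC : IsComoduleCoalgebra k WH WA coact) :
    WH.conv (coactCounit k WH coact) (coactCounit k WH coact) = coactCounit k WH coact := by
  ext h
  let Φ : (H ⊗[k] H) ⊗[k] A →ₗ[k] A := (TensorProduct.lid k A).toLinearMap ∘ₗ
    LinearMap.rTensor A (LinearMap.mul' k k ∘ₗ TensorProduct.map WH.counit WH.counit)
  have key := congrArg Φ (hC.comul_coact h)
  have hL : Φ (LinearMap.rTensor A WH.comul (coact h)) = coactCounit k WH coact h := by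
    simp only [Φ, coactCounit, LinearMap.comp_apply]
    induction coact h with
    | zero => simp
    | tmul a b =>
      have := congrArg WH.counit (WH.counit_comul a)
      simp only [LinearMap.rTensor_tmul, LinearEquiv.coe_coe, TensorProduct.lid_tmul,
        LinearMap.comp_apply]
      congr 1
      rw [← this]
      induction WH.comul a with
      | zero => simp
      | tmul c d => simp
      | add s t hs ht => simp only [map_add, hs, ht]
    | add s t hs ht => simp only [map_add, hs, ht]
  rw [← hL, key, WeakBialgebra.conv_apply]
  induction WH.comul h with
  | zero => simp
  | tmul a b =>
    simp only [TensorProduct.map_tmul, coactCounit, LinearMap.comp_apply, Φ]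
    generalize coact a = s
    generalize coact b = t
    induction s with
    | zero => simp
    | add s s' hs hs' => simp only [map_add, TensorProduct.add_tmul, hs, hs']
    | tmul c d =>
      induction t with
      | zero => simp
      | add s s' hs hs' => simp only [map_add, TensorProduct.tmul_add, hs, hs']
      | tmul e f => simp [smul_smul, mul_comm]
  | add s t hs ht => simp only [map_add, hs, ht]

lemma coact_one (hW : WH.Cocomm) (hM : IsWeakMatchedPair k WH WA act coact) :
    coact 1 = LinearMap.lTensor H (coactCounit k WH coact) (WH.comul 1) := by
  have h1 : (TensorProduct.rid k (H ⊗[k] A)).toLinearMap.comp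
      (LinearMap.lTensor (H ⊗[k] A) WH.counit)
      (LinearMap.rTensor H coact (WH.comul 1)) = coact 1 := by
    conv_rhs => rw [← WH.comul_counit 1]
    induction WH.comul 1 with
    | zero => simp
    | tmul a b => simp
    | add s t hs ht => simp only [map_add, hs, ht]
  have h2 := congrArg (LinearMap.lTensor H ((TensorProduct.lid k A).toLinearMap ∘ₗ
    TensorProduct.map WH.counit (coactCounit k WH coact))) WH.comul_one_left
  have h3 : LinearMap.lTensor H ((TensorProduct.lid k A).toLinearMap ∘ₗ
      TensorProduct.map WH.counit (coactCounit k WH coact))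
      (LinearMap.lTensor H WH.comul (WH.comul 1)) =
      LinearMap.lTensor H (coactCounit k WH coact) (WH.comul 1) := by
    induction WH.comul 1 with
    | zero => simp
    | tmul a b =>
      simp only [LinearMap.lTensor_tmul, LinearMap.comp_apply]
      congr 1
      conv_rhs => rw [← WH.counit_comul b]
      induction WH.comul b with
      | zero => simp
      | tmul c d => simp
      | add s t hs ht => simp only [map_add, hs, ht]
    | add s t hs ht => simp only [map_add, hs, ht]
  rw [← h1, hM.cond5, ← h3, ← h2]
  have h4 : ∀ s t : H ⊗[k] H,
      (TensorProduct.rid k (H ⊗[k] A)).toLinearMap.comp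
        (LinearMap.lTensor (H ⊗[k] A) WH.counit)
        (TensorProduct.map (LinearMap.lTensor H (coactCounit k WH coact)) (LinearMap.mul' k H)
          (TensorProduct.tensorTensorTensorComm k H H H H (s ⊗ₜ[k] t))) =
      LinearMap.lTensor H ((TensorProduct.lid k A).toLinearMap ∘ₗ
        TensorProduct.map WH.counit (coactCounit k WH coact))
        ((TensorProduct.assoc k H H H) (s ⊗ₜ[k] (1 : H)) *
          ((1 : H) ⊗ₜ[k] TensorProduct.comm k H H t)) := by
    intro s t
    induction s with
    | zero => simp
    | add s s' hs hs' => simp only [map_add, TensorProduct.add_tmul, add_mul, hs, hs']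
    | tmul a b =>
      induction t with
      | zero => simp
      | add s s' hs hs' => simp only [map_add, TensorProduct.tmul_add, mul_add, hs, hs']
      | tmul c d => simp
  rw [h4, hW 1]

lemma leftComm_lTensor_comul (hW : WH.Cocomm) (h : H) :
    TensorProduct.leftComm k H H H (LinearMap.lTensor H WH.comul (WH.comul h)) =
      LinearMap.lTensor H WH.comul (WH.comul h) := by
  rw [← WH.coassoc]
  induction WH.comul h with
  | zero => simp
  | tmul a b =>
    simp only [LinearMap.rTensor_tmul]
    conv_rhs => rw [← hW a]
    induction WH.comul a with
    | zero => simp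
    | tmul c d => simp
    | add s t hs ht => simp only [map_add, TensorProduct.add_tmul, hs, ht]
  | add s t hs ht => simp only [map_add, hs, ht]

lemma coact_one_mul_self (hW : WH.Cocomm) (hM : IsWeakMatchedPair k WH WA act coact) :
    coact 1 * coact 1 = coact 1 := by
  have h1 : ∀ s t : H ⊗[k] H,
      LinearMap.lTensor H (coactCounit k WH coact) s *
        LinearMap.lTensor H (coactCounit k WH coact) t =
      LinearMap.lTensor H (LinearMap.mul' k A ∘ₗ TensorProduct.map (coactCounit k WH coact)
        (coactCounit k WH coact)) (TensorProduct.leftComm k H H H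
          (TensorProduct.assoc k H H H (TensorProduct.comm k H H s ⊗ₜ[k] (1 : H)) *
            ((1 : H) ⊗ₜ[k] t))) := by
    intro s t
    induction s with
    | zero => simp
    | add s s' hs hs' => simp only [map_add, TensorProduct.add_tmul, add_mul, hs, hs']
    | tmul a b =>
      induction t with
      | zero => simp
      | add s s' hs hs' => simp only [map_add, TensorProduct.tmul_add, mul_add, hs, hs']
      | tmul c d => simp
  rw [coact_one hW hM, h1, hW 1, WH.comul_one_left, leftComm_lTensor_comul hW]
  conv_rhs => rw [← coactCounit_conv_self hM.comoduleCoalgebra]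
  induction WH.comul 1 with
  | zero => simp
  | tmul a b => simp [WeakBialgebra.conv_apply]
  | add s t hs ht => simp only [map_add, hs, ht]

lemma act_mul_counit_eq (hCP : IsCompatiblePair k WH WA act coact) (h : H) (a : A) :
    act h (WA.εs a) = act h 1 * WA.εs a := by
  have key := congrArg ((TensorProduct.rid k A).toLinearMap ∘ₗ
    LinearMap.lTensor A (WA.counit ∘ₗ LinearMap.mulLeft k a)) (hCP.compat2 h 1)
  have h1 : ∀ f : A →ₗ[k] A, ((TensorProduct.rid k A).toLinearMap ∘ₗ
      LinearMap.lTensor A (WA.counit ∘ₗ LinearMap.mulLeft k a))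
      (TensorProduct.map f LinearMap.id (WA.comul 1)) = f (WA.εs a) := by
    intro f
    simp only [WeakBialgebra.εs, LinearMap.comp_apply, TensorProduct.mk_apply,
      LinearMap.mulRight_apply]
    induction WA.comul 1 with
    | zero => simp
    | tmul a b => simp
    | add s t hs ht => simp only [map_add, mul_add, hs, ht]
  have h2 : act 1 = LinearMap.id := LinearMap.ext hCP.pair.moduleAlgebra.one_act
  have h3 : LinearMap.mulLeft k (act 1 1) = LinearMap.id := by
    ext; simp [hCP.pair.moduleAlgebra.one_act]
  rw [h3, h2, h1, h1] at key
  simpa using key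

lemma lTensor_act_coact_one (hCP : IsCompatiblePair k WH WA act coact) (h : H) :
    LinearMap.lTensor H (act h) (coact 1) = ((1 : H) ⊗ₜ[k] act h 1) * coact 1 := by
  rw [coact_one hCP.cocomm hCP.pair]
  induction WH.comul 1 with
  | zero => simp
  | tmul a b =>
    simp only [LinearMap.lTensor_tmul, Algebra.TensorProduct.tmul_mul_tmul, one_mul]
    rw [hCP.pair.comoduleCoalgebra.coact_counit b, act_mul_counit_eq hCP]
  | add s t hs ht => simp only [map_add, mul_add, hs, ht]

lemma act_one_conv_self (hA : IsModuleAlgebra k WH act) :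
    WH.conv (act.flip 1) (act.flip 1) = act.flip 1 := by
  ext h
  have := hA.act_mul h 1 1
  rw [mul_one] at this
  simpa [WeakBialgebra.conv_apply] using this.symm

section Legs

variable (H) in
/-- The embedding of `A ⊗ A` into the outer `A`-legs of `(A ⊗ H) ⊗ R`, along `φ : A → R`. -/
def outerLegs (φ : A →ₐ[k] R) : A ⊗[k] A →ₐ[k] (A ⊗[k] H) ⊗[k] R :=
  Algebra.TensorProduct.map Algebra.TensorProduct.includeLeft φ

variable (H) in
/-- The embedding of `H ⊗ A` into the last two legs of `(A ⊗ H) ⊗ R`, along `φ : A → R`. -/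
def innerLegs (φ : A →ₐ[k] R) : H ⊗[k] A →ₐ[k] (A ⊗[k] H) ⊗[k] R :=
  Algebra.TensorProduct.map Algebra.TensorProduct.includeRight φ

variable (H) in
/-- The embedding of `A` into the last leg of `(A ⊗ H) ⊗ R`, along `φ : A → R`. -/
def lastLeg (φ : A →ₐ[k] R) : A →ₐ[k] (A ⊗[k] H) ⊗[k] R :=
  Algebra.TensorProduct.includeRight.comp φ

@[simp] lemma outerLegs_tmul (φ : A →ₐ[k] R) (a b : A) :
    outerLegs H φ (a ⊗ₜ[k] b) = (a ⊗ₜ[k] (1 : H)) ⊗ₜ[k] φ b := rfl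

@[simp] lemma innerLegs_tmul (φ : A →ₐ[k] R) (h : H) (b : A) :
    innerLegs H φ (h ⊗ₜ[k] b) = ((1 : A) ⊗ₜ[k] h) ⊗ₜ[k] φ b := rfl

@[simp] lemma lastLeg_apply (φ : A →ₐ[k] R) (b : A) :
    lastLeg H φ b = (1 : A ⊗[k] H) ⊗ₜ[k] φ b := rfl

lemma outerLegs_one_tmul (φ : A →ₐ[k] R) (b : A) :
    outerLegs H φ ((1 : A) ⊗ₜ[k] b) = lastLeg H φ b := rfl

lemma innerLegs_one_tmul (φ : A →ₐ[k] R) (b : A) :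
    innerLegs H φ ((1 : H) ⊗ₜ[k] b) = lastLeg H φ b := rfl

lemma map_comp_outerLegs (φ : A →ₐ[k] R) :
    (Algebra.TensorProduct.map (AlgHom.id k (A ⊗[k] H)) φ).comp (outerLegs H (AlgHom.id k A)) =
      outerLegs H φ := by
  ext <;> simp

lemma map_comp_innerLegs (φ : A →ₐ[k] R) :
    (Algebra.TensorProduct.map (AlgHom.id k (A ⊗[k] H)) φ).comp (innerLegs H (AlgHom.id k A)) =
      innerLegs H φ := by
  ext <;> simp

lemma map_comp_lastLeg (φ : A →ₐ[k] R) :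
    (Algebra.TensorProduct.map (AlgHom.id k (A ⊗[k] H)) φ).comp (lastLeg H (AlgHom.id k A)) =
      lastLeg H φ := by
  ext; simp

lemma lTensor_mul_tensorTensorTensorComm (s : A ⊗[k] A) (r : H ⊗[k] A) :
    LinearMap.lTensor (A ⊗[k] H) (LinearMap.mul' k A)
      (TensorProduct.tensorTensorTensorComm k A A H A (s ⊗ₜ[k] r)) =
    outerLegs H (AlgHom.id k A) s * innerLegs H (AlgHom.id k A) r := by
  induction s with
  | zero => simp
  | add s s' hs hs' => simp only [map_add, TensorProduct.add_tmul, add_mul, hs, hs']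
  | tmul a b =>
    induction r with
    | zero => simp
    | add s s' hs hs' => simp only [map_add, TensorProduct.tmul_add, mul_add, hs, hs']
    | tmul c d => simp

end Legs

lemma pairMapA_tmul (a b : H) (t : A ⊗[k] A) :
    pairMapA k act coact ((a ⊗ₜ[k] b) ⊗ₜ[k] t) =
      TensorProduct.map (TensorProduct.lift act) (LinearMap.mul' k A)
        (TensorProduct.tensorTensorTensorComm k H A A A
          (coact a ⊗ₜ[k] LinearMap.lTensor A (act b) t)) := by
  induction t with
  | zero => simp
  | add s t hs ht => simp only [map_add, TensorProduct.tmul_add, hs, ht]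
  | tmul x y =>
    simp only [pairMapA, LinearMap.comp_apply, LinearEquiv.coe_coe, LinearMap.lTensor_tmul,
      TensorProduct.tensorTensorTensorComm_tmul, TensorProduct.map_tmul, LinearMap.rTensor_tmul]
    induction coact a with
    | zero => simp
    | add s t hs ht => simp only [map_add, TensorProduct.add_tmul, hs, ht]
    | tmul c d => simp

lemma pairMapH_tmul (a b : H) (t : H ⊗[k] A) :
    pairMapH k act coact ((a ⊗ₜ[k] b) ⊗ₜ[k] t) = coact a * LinearMap.lTensor H (act b) t := by
  induction t with
  | zero => simp
  | add s t hs ht => simp only [map_add, TensorProduct.tmul_add, mul_add, hs, ht]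
  | tmul x y =>
    simp only [pairMapH, LinearMap.comp_apply, LinearEquiv.coe_coe, LinearMap.lTensor_tmul,
      TensorProduct.tensorTensorTensorComm_tmul, TensorProduct.map_tmul, LinearMap.rTensor_tmul]
    induction coact a with
    | zero => simp
    | add s t hs ht => simp only [map_add, TensorProduct.add_tmul, add_mul, hs, ht]
    | tmul c d => simp

lemma pairMapA_comul_one (hCP : IsCompatiblePair k WH WA act coact) (a b : H) :
    pairMapA k act coact ((a ⊗ₜ[k] b) ⊗ₜ[k] WA.comul 1) =
      LinearMap.rTensor A (act.flip 1) (coact a) * ((1 : A) ⊗ₜ[k] act b 1) * WA.comul 1 := by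
  rw [pairMapA_tmul]
  induction coact a with
  | zero => simp
  | add s t hs ht => simp only [map_add, TensorProduct.add_tmul, add_mul, hs, ht]
  | tmul p q =>
    have h1 : ∀ t : A ⊗[k] A, TensorProduct.map (TensorProduct.lift act) (LinearMap.mul' k A)
        (TensorProduct.tensorTensorTensorComm k H A A A
          ((p ⊗ₜ[k] q) ⊗ₜ[k] LinearMap.lTensor A (act b) t)) =
        ((1 : A) ⊗ₜ[k] q) * TensorProduct.map (act p) (act b) t := by
      intro t
      induction t with
      | zero => simp
      | add s t hs ht => simp only [map_add, TensorProduct.tmul_add, mul_add, hs, ht]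
      | tmul x y => simp
    rw [h1, hCP.compat2]
    induction WA.comul 1 with
    | zero => simp
    | add s t hs ht => simp only [map_add, mul_add, hs, ht]
    | tmul x y => simp [mul_assoc]

lemma pairMapH_coact_one (hCP : IsCompatiblePair k WH WA act coact) (a b : H) :
    pairMapH k act coact ((a ⊗ₜ[k] b) ⊗ₜ[k] coact 1) =
      coact a * ((1 : H) ⊗ₜ[k] act b 1) * coact 1 := by
  rw [pairMapH_tmul, lTensor_act_coact_one hCP, mul_assoc]

lemma mpLHS_one_one (h : H) :
    mpLHS k WH WA act coact h 1 1 =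
      WH.conv ((outerLegs H (AlgHom.id k A)).toLinearMap ∘ₗ WA.comul ∘ₗ act.flip 1)
        ((innerLegs H (AlgHom.id k A)).toLinearMap ∘ₗ coact) h := by
  rw [mpLHS, WeakBialgebra.conv_apply]
  induction WH.comul h with
  | zero => simp
  | add s t hs ht => simp only [map_add, hs, ht]
  | tmul a b =>
    rw [TensorProduct.map_tmul, lTensor_mul_tensorTensorTensorComm]
    simp

lemma tensor_mul_comm (hA : ∀ a b : A, a * b = b * a) (s t : A ⊗[k] A) : s * t = t * s := by
  induction s with
  | zero => simp
  | add s s' hs hs' => simp only [add_mul, mul_add, hs, hs']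
  | tmul a b =>
    induction t with
    | zero => simp
    | add s s' hs hs' => simp only [add_mul, mul_add, hs, hs']
    | tmul c d => simp [hA a c, hA b d]

lemma mpRHS_one_one (hCP : IsCompatiblePair k WH WA act coact) (h : H) :
    mpRHS k WH WA act coact h 1 1 =
      outerLegs H (AlgHom.id k A) (WA.comul 1) *
        WH.conv ((outerLegs H (AlgHom.id k A)).toLinearMap ∘ₗ
            LinearMap.rTensor A (act.flip 1) ∘ₗ coact)
          (WH.conv ((lastLeg H (AlgHom.id k A)).toLinearMap ∘ₗ act.flip 1)
            (WH.conv ((innerLegs H (AlgHom.id k A)).toLinearMap ∘ₗ coact)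
              ((lastLeg H (AlgHom.id k A)).toLinearMap ∘ₗ act.flip 1))) h *
        innerLegs H (AlgHom.id k A) (coact 1) := by
  rw [mpRHS, WeakBialgebra.conv_conv_conv_apply]
  induction threeComul k WH h with
  | zero => simp
  | add s t hs ht => simp only [map_add, add_mul, mul_add, hs, ht]
  | tmul a t =>
    induction t with
    | zero => simp
    | add s t hs ht => simp only [map_add, TensorProduct.tmul_add, add_mul, mul_add, hs, ht]
    | tmul b t =>
      induction t with
      | zero => simp
      | add s t hs ht => simp only [map_add, TensorProduct.tmul_add, add_mul, mul_add, hs, ht]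
      | tmul c d =>
        rw [TensorProduct.assoc_symm_tmul, TensorProduct.map_tmul,
          lTensor_mul_tensorTensorTensorComm]
        simp only [LinearMap.comp_apply, LinearMap.flip_apply, TensorProduct.mk_apply,
          pairMapA_comul_one hCP, pairMapH_coact_one hCP, TensorProduct.map_tmul,
          LinearMap.mul'_apply, AlgHom.toLinearMap_apply]
        rw [tensor_mul_comm hCP.comm _ (WA.comul 1)]
        simp only [map_mul, outerLegs_one_tmul, innerLegs_one_tmul, mul_assoc]

/-- The map `ε ⊗ id ⊗ id` on `(A ⊗ H) ⊗ A`. -/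
def counitFirst (H : Type*) [Ring H] [Algebra k H] (WA : WeakBialgebra k A) :
    (A ⊗[k] H) ⊗[k] A →ₗ[k] H ⊗[k] A :=
  LinearMap.rTensor A ((TensorProduct.lid k H).toLinearMap ∘ₗ LinearMap.rTensor H WA.counit)

lemma counitFirst_mul_innerLegs (z : (A ⊗[k] H) ⊗[k] A) (r : H ⊗[k] A) :
    counitFirst H WA (z * innerLegs H (AlgHom.id k A) r) = counitFirst H WA z * r := by
  induction r with
  | zero => simp
  | add s t hs ht => simp only [map_add, mul_add, hs, ht]
  | tmul c d =>
    induction z with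
    | zero => simp
    | add s t hs ht => simp only [map_add, add_mul, hs, ht]
    | tmul y b =>
      induction y with
      | zero => simp
      | add s t hs ht => simp only [map_add, TensorProduct.add_tmul, add_mul, hs, ht]
      | tmul a g => simp [counitFirst]

lemma counitFirst_outerLegs_comul (x : A) :
    counitFirst H WA (outerLegs H (AlgHom.id k A) (WA.comul x)) = (1 : H) ⊗ₜ[k] x := by
  conv_rhs => rw [← WA.counit_comul x]
  induction WA.comul x with
  | zero => simp
  | add s t hs ht => simp only [map_add, TensorProduct.tmul_add, hs, ht]
  | tmul a b => simp [counitFirst, TensorProduct.smul_tmul]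

lemma counitFirst_mpLHS (h : H) :
    counitFirst H WA (mpLHS k WH WA act coact h 1 1) =
      WH.conv ((Algebra.TensorProduct.includeRight (R := k) (A := H)).toLinearMap ∘ₗ act.flip 1)
        coact h := by
  rw [mpLHS_one_one, WeakBialgebra.conv_apply, WeakBialgebra.conv_apply]
  induction WH.comul h with
  | zero => simp
  | add s t hs ht => simp only [map_add, hs, ht]
  | tmul a b => simp [counitFirst_mul_innerLegs, counitFirst_outerLegs_comul]

lemma conv_coact_mul_coact_one (hCP : IsCompatiblePair k WH WA act coact) (h : H) :
    WH.conv ((Algebra.TensorProduct.includeRight (R := k) (A := H)).toLinearMap ∘ₗ act.flip 1)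
        coact h * coact 1 =
      WH.conv ((Algebra.TensorProduct.includeRight (R := k) (A := H)).toLinearMap ∘ₗ act.flip 1)
        coact h := by
  rw [← counitFirst_mpLHS (WA := WA), hCP.pair.cond3, mpRHS_one_one hCP,
    counitFirst_mul_innerLegs, mul_assoc, coact_one_mul_self hCP.cocomm hCP.pair]

lemma commute_lastLeg_innerLegs (hA : ∀ a b : A, a * b = b * a) (φ : A →ₐ[k] R) (a : A)
    (r : H ⊗[k] A) : Commute (lastLeg H φ a) (innerLegs H φ r) := by
  induction r with
  | zero => simp
  | add s t hs ht => rw [map_add]; exact hs.add_right ht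
  | tmul h b => simp [commute_iff_eq, ← map_mul, hA a b]

lemma conv_outerLegs_comul (hCP : IsCompatiblePair k WH WA act coact) (h : H) :
    WH.conv ((outerLegs H (AlgHom.id k A)).toLinearMap ∘ₗ WA.comul ∘ₗ act.flip 1)
        ((innerLegs H (AlgHom.id k A)).toLinearMap ∘ₗ coact) h =
      outerLegs H (AlgHom.id k A) (WA.comul 1) *
        WH.conv ((outerLegs H (AlgHom.id k A)).toLinearMap ∘ₗ
            LinearMap.rTensor A (act.flip 1) ∘ₗ coact)
          (WH.conv ((lastLeg H (AlgHom.id k A)).toLinearMap ∘ₗ act.flip 1)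
            ((innerLegs H (AlgHom.id k A)).toLinearMap ∘ₗ coact)) h := by
  set V := (outerLegs H (AlgHom.id k A)).toLinearMap ∘ₗ
    LinearMap.rTensor A (act.flip 1) ∘ₗ coact
  set U := (lastLeg H (AlgHom.id k A)).toLinearMap ∘ₗ act.flip 1 with hU
  set P := (innerLegs H (AlgHom.id k A)).toLinearMap ∘ₗ coact with hP
  have hPU : WH.conv P U = WH.conv U P :=
    WH.conv_comm hCP.cocomm _ _ fun a b ↦ (commute_lastLeg_innerLegs hCP.comm _ _ _).symm
  have hUU : WH.conv U U = U := by
    ext g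
    rw [hU, ← WeakBialgebra.algHom_conv, act_one_conv_self hCP.pair.moduleAlgebra]
    rfl
  have hUP : LinearMap.mulRight k (innerLegs H (AlgHom.id k A) (coact 1)) ∘ₗ WH.conv U P =
      WH.conv U P := by
    ext g
    have h1 : WH.conv U P g = innerLegs H (AlgHom.id k A) (WH.conv
        ((Algebra.TensorProduct.includeRight (R := k) (A := H)).toLinearMap ∘ₗ act.flip 1)
        coact g) := by
      rw [WeakBialgebra.algHom_conv]
      rfl
    rw [LinearMap.comp_apply, LinearMap.mulRight_apply, h1, ← map_mul,
      conv_coact_mul_coact_one hCP]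
  rw [← mpLHS_one_one, hCP.pair.cond3, mpRHS_one_one hCP, mul_assoc, hPU, ← WH.conv_assoc U U,
    hUU]
  conv_rhs => rw [← hUP, ← WH.conv_mul]
  rfl

variable (k A H) in
/-- The embedding of `H` into the last leg of `(A ⊗ H) ⊗ (A ⊗ H)`. -/
def lastLegH : H →ₐ[k] (A ⊗[k] H) ⊗[k] (A ⊗[k] H) :=
  Algebra.TensorProduct.includeRight.comp Algebra.TensorProduct.includeRight

@[simp] lemma lastLegH_apply (h : H) :
    lastLegH k H A h = (1 : A ⊗[k] H) ⊗ₜ[k] ((1 : A) ⊗ₜ[k] h) := rfl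

/-- The `A`-leg inclusion `A → A ⊗ H`. -/
abbrev inA (k A H : Type*) [Field k] [Ring H] [Algebra k H] [Ring A] [Algebra k A] :
    A →ₐ[k] A ⊗[k] H :=
  Algebra.TensorProduct.includeLeft

lemma smashComul_tmul (x : A) (h : H) :
    smashComul k WH WA coact (x ⊗ₜ[k] h) =
      outerLegs H (inA k A H) (WA.comul x) *
        WH.conv ((innerLegs H (inA k A H)).toLinearMap ∘ₗ coact) (lastLegH k H A).toLinearMap h := by
  rw [WeakBialgebra.conv_apply]
  simp only [smashComul, LinearMap.comp_apply, TensorProduct.map_tmul, LinearMap.lTensor_tmul,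
    LinearEquiv.coe_coe]
  induction WH.comul h with
  | zero => simp
  | add s t hs ht => simp only [map_add, TensorProduct.tmul_add, mul_add, hs, ht]
  | tmul g l =>
    simp only [TensorProduct.map_tmul, LinearMap.rTensor_tmul, LinearMap.comp_apply,
      TensorProduct.assoc_symm_tmul, LinearEquiv.coe_coe]
    rw [lTensor_mul_tensorTensorTensorComm]
    generalize WA.comul x = s
    induction s with
    | zero => simp
    | add s t hs ht => simp only [map_add, TensorProduct.add_tmul, add_mul, hs, ht]
    | tmul a b =>
      generalize coact g = r
      induction r with
      | zero => simp
      | add s t hs ht => simp only [map_add, TensorProduct.add_tmul, mul_add, hs, ht]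
      | tmul c d => simp

lemma projUnder_tmul (x : A) (h : H) :
    projUnder k WH act (x ⊗ₜ[k] h) =
      TensorProduct.map (LinearMap.mulLeft k x ∘ₗ act.flip 1) LinearMap.id (WH.comul h) := by
  simp only [projUnder, smashMul, LinearMap.comp_apply, TensorProduct.mk_apply,
    LinearMap.flip_apply, LinearMap.rTensor_tmul, LinearMap.lTensor_tmul, LinearEquiv.coe_coe,
    TensorProduct.assoc_tmul]
  induction WH.comul h with
  | zero => simp
  | add s t hs ht => simp only [map_add, TensorProduct.add_tmul, TensorProduct.tmul_add, hs, ht]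
  | tmul a b => simp

lemma projUnder_mul (x : A) (y : A ⊗[k] H) :
    projUnder k WH act ((x ⊗ₜ[k] (1 : H)) * y) = (x ⊗ₜ[k] (1 : H)) * projUnder k WH act y := by
  induction y with
  | zero => simp
  | add s t hs ht => simp only [map_add, mul_add, hs, ht]
  | tmul y h =>
    rw [Algebra.TensorProduct.tmul_mul_tmul, one_mul, projUnder_tmul, projUnder_tmul]
    induction WH.comul h with
    | zero => simp
    | add s t hs ht => simp only [map_add, mul_add, hs, ht]
    | tmul a b => simp

lemma smashComul_projUnder_tmul (x : A) (h : H) :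
    smashComul k WH WA coact (projUnder k WH act (x ⊗ₜ[k] h)) =
      outerLegs H (inA k A H) (WA.comul x) *
        WH.conv ((outerLegs H (inA k A H)).toLinearMap ∘ₗ WA.comul ∘ₗ act.flip 1)
          (WH.conv ((innerLegs H (inA k A H)).toLinearMap ∘ₗ coact)
            (lastLegH k H A).toLinearMap) h := by
  rw [projUnder_tmul, WH.conv_apply _ (WH.conv _ _)]
  induction WH.comul h with
  | zero => simp
  | add s t hs ht => simp only [map_add, mul_add, hs, ht]
  | tmul a b => simp [smashComul_tmul, WA.comul_mul, mul_assoc]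

lemma comodule_comul_eq (hC : IsComoduleCoalgebra k WH WA coact)
    (f : H →ₗ[k] R) (g : H →ₗ[k] R) (φ : A →ₐ[k] R) (hφ : ∀ a h, Commute (φ a) (g h)) (h : H) :
    LinearMap.mul' k R (TensorProduct.map (LinearMap.mul' k R ∘ₗ TensorProduct.map f g)
        φ.toLinearMap (LinearMap.rTensor A WH.comul (coact h))) =
      WH.conv (LinearMap.mul' k R ∘ₗ TensorProduct.map f φ.toLinearMap ∘ₗ coact)
        (LinearMap.mul' k R ∘ₗ TensorProduct.map g φ.toLinearMap ∘ₗ coact) h := by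
  rw [hC.comul_coact, WeakBialgebra.conv_apply]
  induction WH.comul h with
  | zero => simp
  | add s t hs ht => simp only [map_add, hs, ht]
  | tmul a b =>
    simp only [TensorProduct.map_tmul, LinearMap.comp_apply]
    generalize coact a = r
    generalize coact b = s
    induction r with
    | zero => simp
    | add s t hs ht => simp only [map_add, TensorProduct.add_tmul, hs, ht]
    | tmul c d =>
      induction s with
      | zero => simp
      | add s t hs ht => simp only [map_add, TensorProduct.tmul_add, hs, ht]
      | tmul p q =>
        have := hφ d p
        simp only [TensorProduct.tensorTensorTensorComm_tmul, LinearMap.lTensor_tmul,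
          TensorProduct.map_tmul, LinearMap.mul'_apply, LinearMap.comp_apply,
          AlgHom.toLinearMap_apply, map_mul]
        rw [mul_assoc, mul_assoc, ← mul_assoc (g p), ← this.eq, mul_assoc]

lemma map_projUnder_mul (s : A ⊗[k] A) (z : (A ⊗[k] H) ⊗[k] (A ⊗[k] H)) :
    TensorProduct.map (projUnder k WH act) (projUnder k WH act) (outerLegs H (inA k A H) s * z) =
      outerLegs H (inA k A H) s *
        TensorProduct.map (projUnder k WH act) (projUnder k WH act) z := by
  induction s with
  | zero => simp
  | add s t hs ht => simp only [map_add, add_mul, hs, ht]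
  | tmul a b =>
    induction z with
    | zero => simp
    | add s t hs ht => simp only [map_add, mul_add, hs, ht]
    | tmul y w => simp [projUnder_mul]

lemma one_tmul_projUnder (h : H) :
    (1 : A ⊗[k] H) ⊗ₜ[k] projUnder k WH act ((1 : A) ⊗ₜ[k] h) =
      WH.conv ((lastLeg H (inA k A H)).toLinearMap ∘ₗ act.flip 1)
        (lastLegH k H A).toLinearMap h := by
  rw [projUnder_tmul, WeakBialgebra.conv_apply]
  induction WH.comul h with
  | zero => simp
  | add s t hs ht => simp only [map_add, TensorProduct.tmul_add, hs, ht]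
  | tmul a b => simp

lemma map_projUnder_coact (hC : IsComoduleCoalgebra k WH WA coact)
    (h : H) :
    TensorProduct.map (projUnder k WH act ∘ₗ TensorProduct.mk k A H 1)
        (inA k A H).toLinearMap (coact h) =
      WH.conv ((outerLegs H (inA k A H)).toLinearMap ∘ₗ
          LinearMap.rTensor A (act.flip 1) ∘ₗ coact)
        ((innerLegs H (inA k A H)).toLinearMap ∘ₗ coact) h := by
  let f : H →ₗ[k] (A ⊗[k] H) ⊗[k] (A ⊗[k] H) :=
    (Algebra.TensorProduct.includeLeft.toLinearMap ∘ₗ (inA k A H).toLinearMap) ∘ₗ act.flip 1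
  let g : H →ₗ[k] (A ⊗[k] H) ⊗[k] (A ⊗[k] H) :=
    (Algebra.TensorProduct.includeLeft (R := k) (S := k) (A := A ⊗[k] H)
      (B := A ⊗[k] H)).toLinearMap ∘ₗ
      (Algebra.TensorProduct.includeRight (R := k) (A := A) (B := H)).toLinearMap
  have h1 : (outerLegs H (inA k A H)).toLinearMap ∘ₗ
      LinearMap.rTensor A (act.flip 1) ∘ₗ coact = LinearMap.mul' k _ ∘ₗ
        TensorProduct.map f (lastLeg H (inA k A H)).toLinearMap ∘ₗ coact := by
    simp only [← LinearMap.comp_assoc]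
    congr 1
    ext a b
    simp [f]
  have h2 : (innerLegs H (inA k A H)).toLinearMap ∘ₗ coact = LinearMap.mul' k _ ∘ₗ
        TensorProduct.map g (lastLeg H (inA k A H)).toLinearMap ∘ₗ coact := by
    simp only [← LinearMap.comp_assoc]
    congr 1
    ext a b
    simp [g]
  rw [h1, h2, ← comodule_comul_eq hC f g _ (fun a h ↦ by simp [commute_iff_eq, g])]
  induction coact h with
  | zero => simp
  | add s t hs ht => simp only [map_add, hs, ht]
  | tmul a b =>
    simp only [TensorProduct.map_tmul, LinearMap.rTensor_tmul, LinearMap.comp_apply,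
      TensorProduct.mk_apply, projUnder_tmul]
    induction WH.comul a with
    | zero => simp
    | add s t hs ht => simp only [map_add, TensorProduct.add_tmul, hs, ht]
    | tmul c d => simp [f, g]

lemma map_projUnder_inner (r : H ⊗[k] A) (h : H) :
    TensorProduct.map (projUnder k WH act) (projUnder k WH act)
        (innerLegs H (inA k A H) r * lastLegH k H A h) =
      TensorProduct.map (projUnder k WH act ∘ₗ TensorProduct.mk k A H 1)
        (inA k A H).toLinearMap r *
        ((1 : A ⊗[k] H) ⊗ₜ[k] projUnder k WH act ((1 : A) ⊗ₜ[k] h)) := by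
  induction r with
  | zero => simp
  | add s t hs ht => simp only [map_add, add_mul, hs, ht]
  | tmul a b =>
    have := projUnder_mul (WH := WH) (act := act) b ((1 : A) ⊗ₜ[k] h)
    simp only [Algebra.TensorProduct.tmul_mul_tmul, mul_one, one_mul] at this
    simp [this]

lemma smashComul_projUnder (hCP : IsCompatiblePair k WH WA act coact) (x : A) (h : H) :
    smashComul k WH WA coact (projUnder k WH act (x ⊗ₜ[k] h)) =
      TensorProduct.map (projUnder k WH act) (projUnder k WH act)
        (smashComul k WH WA coact (x ⊗ₜ[k] h)) := by
  set V := (outerLegs H (inA k A H)).toLinearMap ∘ₗ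
    LinearMap.rTensor A (act.flip 1) ∘ₗ coact with hV
  set U := (lastLeg H (inA k A H)).toLinearMap ∘ₗ act.flip 1 with hU
  set P := (innerLegs H (inA k A H)).toLinearMap ∘ₗ coact with hP
  set Q := (lastLegH k H A).toLinearMap
  set D := (outerLegs H (inA k A H)).toLinearMap ∘ₗ WA.comul ∘ₗ act.flip 1
  have h1 : TensorProduct.map (projUnder k WH act) (projUnder k WH act)
      (WH.conv P Q h) = WH.conv (WH.conv V P) (WH.conv U Q) h := by
    rw [WH.conv_apply P, WH.conv_apply (WH.conv V P)]
    induction WH.comul h with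
    | zero => simp
    | add s t hs ht => simp only [map_add, hs, ht]
    | tmul a b =>
      simp only [TensorProduct.map_tmul, LinearMap.mul'_apply]
      rw [hV, hP, hU, ← map_projUnder_coact hCP.pair.comoduleCoalgebra,
        ← one_tmul_projUnder, ← map_projUnder_inner]
      rfl
  have h2 : WH.conv D P = LinearMap.mulLeft k (outerLegs H (inA k A H) (WA.comul 1)) ∘ₗ
      WH.conv V (WH.conv U P) := by
    ext g
    have := congrArg (Algebra.TensorProduct.map (AlgHom.id k (A ⊗[k] H)) (inA k A H))
      (conv_outerLegs_comul hCP g)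
    rw [map_mul] at this
    simp only [WeakBialgebra.algHom_conv, WeakBialgebra.algHom_comp_conv, ← LinearMap.comp_assoc,
      ← AlgHom.comp_toLinearMap, map_comp_outerLegs, map_comp_innerLegs,
      map_comp_lastLeg] at this
    rw [← AlgHom.comp_apply, map_comp_outerLegs] at this
    exact this
  have hPU : WH.conv P U = WH.conv U P :=
    WH.conv_comm hCP.cocomm _ _ fun a b ↦ (commute_lastLeg_innerLegs hCP.comm _ _ _).symm
  rw [smashComul_projUnder_tmul, smashComul_tmul, map_projUnder_mul, h1, ← WH.conv_assoc, h2,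
    ← WH.mul_conv, LinearMap.comp_apply, LinearMap.mulLeft_apply, ← mul_assoc, ← map_mul,
    ← WA.comul_mul, mul_one, ← hPU]
  simp only [WH.conv_assoc]
  rfl

/-- The right `A`-coaction `x ⊗ h ↦ (x₁ ⊗ h⁰) ⊗ x₂ h¹` on `A ⊗ H`. -/
def smashCoact (WA : WeakBialgebra k A) (coact : H →ₗ[k] H ⊗[k] A) :
    A ⊗[k] H →ₗ[k] (A ⊗[k] H) ⊗[k] A :=
  LinearMap.lTensor (A ⊗[k] H) (LinearMap.mul' k A) ∘ₗ
    (TensorProduct.tensorTensorTensorComm k A A H A).toLinearMap ∘ₗ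
    TensorProduct.map WA.comul coact

lemma smashCoact_tmul (x : A) (h : H) :
    smashCoact WA coact (x ⊗ₜ[k] h) =
      outerLegs H (AlgHom.id k A) (WA.comul x) * innerLegs H (AlgHom.id k A) (coact h) :=
  lTensor_mul_tensorTensorTensorComm _ _

lemma smashComul_eq_rTensor_smashCoact (x : A) (h : H) :
    smashComul k WH WA coact (x ⊗ₜ[k] h) =
      TensorProduct.assoc k (A ⊗[k] H) A H (LinearMap.rTensor H (smashCoact WA coact)
        ((TensorProduct.assoc k A H H).symm (x ⊗ₜ[k] WH.comul h))) := by
  simp only [smashComul, LinearMap.comp_apply, TensorProduct.map_tmul, LinearMap.lTensor_tmul,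
    LinearEquiv.coe_coe]
  induction WH.comul h with
  | zero => simp
  | add s t hs ht => simp only [map_add, TensorProduct.tmul_add, hs, ht]
  | tmul a b => simp [smashCoact]

lemma projBar_eq_smashCoact (u : A ⊗[k] H) :
    projBar k WH WA coact u =
      TensorProduct.rid k (A ⊗[k] H) (LinearMap.lTensor (A ⊗[k] H) WA.counit
        (smashCoact WA coact u)) := by
  induction u with
  | zero => simp
  | add s t hs ht => simp only [map_add, hs, ht]
  | tmul x h =>
    simp only [projBar, LinearMap.comp_apply, smashComul_eq_rTensor_smashCoact]
    conv_rhs => rw [← WH.comul_counit h]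
    induction WH.comul h with
    | zero => simp
    | add s t hs ht => simp only [map_add, TensorProduct.tmul_add, hs, ht]
    | tmul a b =>
      simp only [TensorProduct.assoc_symm_tmul, LinearMap.rTensor_tmul, LinearMap.lTensor_tmul,
        TensorProduct.rid_tmul, TensorProduct.tmul_smul, map_smul]
      induction smashCoact WA coact (x ⊗ₜ[k] a) with
      | zero => simp
      | add s t hs ht => simp only [map_add, TensorProduct.add_tmul, smul_add, hs, ht]
      | tmul y c => simp [smashCounit, smul_smul, mul_comm]

lemma rTensor_projBar_legs (s : A ⊗[k] A) (r : H ⊗[k] A) :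
    LinearMap.rTensor A (projBar k WH WA coact)
        (outerLegs H (AlgHom.id k A) s * innerLegs H (AlgHom.id k A) r) =
      TensorProduct.map LinearMap.id ((TensorProduct.lid k A).toLinearMap ∘ₗ
          LinearMap.rTensor A WA.counit ∘ₗ LinearMap.mul' k (A ⊗[k] A))
        (TensorProduct.tensorTensorTensorComm k A (A ⊗[k] A) H (A ⊗[k] A)
          (TensorProduct.assoc k A A A (LinearMap.rTensor A WA.comul s) ⊗ₜ[k]
            TensorProduct.assoc k H A A (LinearMap.rTensor A coact r))) := by
  induction s with
  | zero => simp
  | add s t hs ht => simp only [map_add, TensorProduct.add_tmul, add_mul, hs, ht]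
  | tmul a b =>
    induction r with
    | zero => simp
    | add s t hs ht => simp only [map_add, TensorProduct.tmul_add, mul_add, hs, ht]
    | tmul c d =>
      simp only [outerLegs_tmul, innerLegs_tmul, Algebra.TensorProduct.tmul_mul_tmul, mul_one,
        one_mul, LinearMap.rTensor_tmul, projBar_eq_smashCoact, smashCoact_tmul, AlgHom.id_apply]
      generalize WA.comul a = s
      generalize coact c = r
      induction s with
      | zero => simp
      | add s t hs ht => simp only [map_add, TensorProduct.add_tmul, add_mul, hs, ht]
      | tmul a b =>
        induction r with
        | zero => simp
        | add s t hs ht =>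
          simp only [map_add, TensorProduct.tmul_add, TensorProduct.add_tmul, mul_add, hs, ht]
        | tmul c d => simp [TensorProduct.smul_tmul]

lemma rTensor_projBar_smashCoact (hC : IsComoduleCoalgebra k WH WA coact) (u : A ⊗[k] H) :
    LinearMap.rTensor A (projBar k WH WA coact) (smashCoact WA coact u) =
      smashCoact WA coact u := by
  induction u with
  | zero => simp
  | add s t hs ht => simp only [map_add, hs, ht]
  | tmul x h =>
    rw [smashCoact_tmul, rTensor_projBar_legs, WA.coassoc, hC.coact_coact]
    generalize WA.comul x = s
    generalize coact h = r
    induction s with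
    | zero => simp
    | add s t hs ht => simp only [map_add, TensorProduct.add_tmul, add_mul, hs, ht]
    | tmul a b =>
      induction r with
      | zero => simp
      | add s t hs ht => simp only [map_add, TensorProduct.tmul_add, mul_add, hs, ht]
      | tmul c d => simp [← WA.comul_mul, WA.counit_comul]

lemma rTensor_projBar_smashComul (hC : IsComoduleCoalgebra k WH WA coact) (u : A ⊗[k] H) :
    LinearMap.rTensor (A ⊗[k] H) (projBar k WH WA coact) (smashComul k WH WA coact u) =
      smashComul k WH WA coact u := by
  induction u with
  | zero => simp
  | add s t hs ht => simp only [map_add, hs, ht]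
  | tmul x h =>
    rw [smashComul_eq_rTensor_smashCoact]
    induction WH.comul h with
    | zero => simp
    | add s t hs ht => simp only [map_add, TensorProduct.tmul_add, hs, ht]
    | tmul a b =>
      simp only [TensorProduct.assoc_symm_tmul, LinearMap.rTensor_tmul]
      conv_rhs => rw [← rTensor_projBar_smashCoact (WH := WH) hC]
      induction smashCoact WA coact (x ⊗ₜ[k] a) with
      | zero => simp
      | add s t hs ht => simp only [map_add, TensorProduct.add_tmul, hs, ht]
      | tmul y c => simp

/-- If `D (x ⊗ h) = o(Δ x) i(ρ h)`, then `(id ⊗ D) Δ` is again such a product. -/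
lemma lTensor_smashComul {D : A ⊗[k] H →ₗ[k] R} {o : A ⊗[k] A →ₐ[k] R} {i : H ⊗[k] A →ₐ[k] R}
    (hD : ∀ x h, D (x ⊗ₜ[k] h) = o (WA.comul x) * i (coact h)) (x : A) (h : H) :
    LinearMap.lTensor (A ⊗[k] H) D (smashComul k WH WA coact (x ⊗ₜ[k] h)) =
      Algebra.TensorProduct.map (inA k A H) o (LinearMap.lTensor A WA.comul (WA.comul x)) *
        WH.conv
          ((Algebra.TensorProduct.map (Algebra.TensorProduct.includeRight : H →ₐ[k] A ⊗[k] H)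
            o).toLinearMap ∘ₗ LinearMap.lTensor H WA.comul ∘ₗ coact)
          (TensorProduct.mk k (A ⊗[k] H) R 1 ∘ₗ i.toLinearMap ∘ₗ coact) h := by
  rw [smashComul_tmul, WeakBialgebra.conv_apply, WeakBialgebra.conv_apply]
  induction WH.comul h with
  | zero => simp
  | add s t hs ht => simp only [map_add, mul_add, hs, ht]
  | tmul a b =>
    simp only [TensorProduct.map_tmul, LinearMap.mul'_apply, LinearMap.comp_apply,
      AlgHom.toLinearMap_apply]
    generalize WA.comul x = s
    generalize coact a = r
    induction s with
    | zero => simp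
    | add s t hs ht => simp only [map_add, add_mul, hs, ht]
    | tmul c d =>
      induction r with
      | zero => simp
      | add s t hs ht => simp only [map_add, mul_add, add_mul, hs, ht]
      | tmul e f => simp [hD, WA.comul_mul, mul_assoc]

lemma assoc_rTensor_legs {D : A ⊗[k] H →ₗ[k] R ⊗[k] S} {o₁ : A →ₐ[k] R} {o₂ : A →ₐ[k] S}
    {P : H →ₗ[k] R ⊗[k] S}
    (hD : ∀ x h, D (x ⊗ₜ[k] h) = Algebra.TensorProduct.map o₁ o₂ (WA.comul x) * P h)
    (s : A ⊗[k] A) (r : H ⊗[k] A) :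
    TensorProduct.assoc k R S A (LinearMap.rTensor A D
        (outerLegs H (AlgHom.id k A) s * innerLegs H (AlgHom.id k A) r)) =
      Algebra.TensorProduct.map o₁ (Algebra.TensorProduct.map o₂ (AlgHom.id k A))
          (TensorProduct.assoc k A A A (LinearMap.rTensor A WA.comul s)) *
        TensorProduct.assoc k R S A (LinearMap.rTensor A P r) := by
  induction s with
  | zero => simp
  | add s t hs ht => simp only [map_add, add_mul, hs, ht]
  | tmul a b =>
    induction r with
    | zero => simp
    | add s t hs ht => simp only [map_add, mul_add, hs, ht]
    | tmul c d =>
      simp only [outerLegs_tmul, innerLegs_tmul, Algebra.TensorProduct.tmul_mul_tmul, mul_one,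
        one_mul, LinearMap.rTensor_tmul, hD, AlgHom.id_apply]
      generalize WA.comul a = s
      generalize P c = z
      induction s with
      | zero => simp
      | add s t hs ht => simp only [map_add, TensorProduct.add_tmul, add_mul, hs, ht]
      | tmul a b =>
        induction z with
        | zero => simp
        | add s t hs ht => simp only [map_add, TensorProduct.add_tmul, mul_add, hs, ht]
        | tmul y w => simp

lemma assoc_tmul_eq (z : R ⊗[k] S) (d : A) :
    TensorProduct.assoc k R S A (z ⊗ₜ[k] d) =
      Algebra.TensorProduct.map (AlgHom.id k R)
          (Algebra.TensorProduct.includeLeft : S →ₐ[k] S ⊗[k] A) z *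
        ((1 : R) ⊗ₜ[k] ((1 : S) ⊗ₜ[k] d)) := by
  induction z with
  | zero => simp
  | add s t hs ht => simp only [map_add, TensorProduct.add_tmul, add_mul, hs, ht]
  | tmul y w => simp

/-- The comodule coalgebra law for the map `h ↦ P(h⁰) ⊗ h¹` with `P` a convolution product. -/
lemma assoc_rTensor_conv (hC : IsComoduleCoalgebra k WH WA coact) (P Q : H →ₗ[k] R ⊗[k] S)
    (h : H) :
    TensorProduct.assoc k R S A (LinearMap.rTensor A (WH.conv P Q) (coact h)) =
      WH.conv ((TensorProduct.assoc k R S A).toLinearMap ∘ₗ LinearMap.rTensor A P ∘ₗ coact)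
        ((TensorProduct.assoc k R S A).toLinearMap ∘ₗ LinearMap.rTensor A Q ∘ₗ coact) h := by
  let j : R ⊗[k] S →ₐ[k] R ⊗[k] (S ⊗[k] A) :=
    Algebra.TensorProduct.map (AlgHom.id k R) Algebra.TensorProduct.includeLeft
  let φ : A →ₐ[k] R ⊗[k] (S ⊗[k] A) :=
    Algebra.TensorProduct.includeRight.comp Algebra.TensorProduct.includeRight
  have hj (P : H →ₗ[k] R ⊗[k] S) :
      (TensorProduct.assoc k R S A).toLinearMap ∘ₗ LinearMap.rTensor A P =
        LinearMap.mul' k _ ∘ₗ TensorProduct.map (j.toLinearMap ∘ₗ P) φ.toLinearMap :=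
    TensorProduct.ext' fun a b ↦ assoc_tmul_eq (P a) b
  have hφ (a : A) (z : R ⊗[k] S) : Commute (φ a) (j z) := by
    rw [commute_iff_eq]
    induction z with
    | zero => simp
    | add s t hs ht => simp only [map_add, add_mul, mul_add, hs, ht]
    | tmul y w => simp [φ, j]
  rw [← LinearMap.comp_assoc, ← LinearMap.comp_assoc, hj, hj, LinearMap.comp_assoc,
    LinearMap.comp_assoc, ← comodule_comul_eq hC _ _ φ fun a h ↦ hφ a (Q h)]
  refine (LinearMap.congr_fun (hj (WH.conv P Q)) (coact h)).trans ?_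
  rw [WH.algHom_comp_conv, LinearMap.comp_apply]
  congr 1
  induction coact h with
  | zero => simp
  | add s t hs ht => simp only [map_add, hs, ht]
  | tmul a b => rfl

lemma assoc_rTensor_smashComul_smashCoact (hC : IsComoduleCoalgebra k WH WA coact) (x : A)
    (h : H) :
    TensorProduct.assoc k (A ⊗[k] H) (A ⊗[k] H) A
        (LinearMap.rTensor A (smashComul k WH WA coact)
          (smashCoact WA coact (x ⊗ₜ[k] h))) =
      LinearMap.lTensor (A ⊗[k] H) (smashCoact WA coact)
        (smashComul k WH WA coact (x ⊗ₜ[k] h)) := by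
  rw [lTensor_smashComul smashCoact_tmul, smashCoact_tmul, assoc_rTensor_legs smashComul_tmul,
    WA.coassoc, assoc_rTensor_conv hC]
  congr 2
  congr 1
  · ext l
    simp only [LinearMap.comp_apply, ← hC.coact_coact]
    induction coact l with
    | zero => simp
    | add s t hs ht => simp only [map_add, hs, ht]
    | tmul a b =>
      simp only [LinearMap.rTensor_tmul, LinearMap.comp_apply]
      induction coact a with
      | zero => simp
      | add s t hs ht => simp only [map_add, TensorProduct.add_tmul, hs, ht]
      | tmul c d => simp
  · ext l
    simp only [LinearMap.comp_apply]
    induction coact l with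
    | zero => simp
    | add s t hs ht => simp only [map_add, hs, ht]
    | tmul a b => simp

lemma smashComul_projBar (hC : IsComoduleCoalgebra k WH WA coact) (u : A ⊗[k] H) :
    smashComul k WH WA coact (projBar k WH WA coact u) =
      TensorProduct.map (projBar k WH WA coact) (projBar k WH WA coact)
        (smashComul k WH WA coact u) := by
  have h1 : smashComul k WH WA coact (projBar k WH WA coact u) =
      LinearMap.lTensor (A ⊗[k] H) (projBar k WH WA coact) (smashComul k WH WA coact u) := by
    have h2 : projBar k WH WA coact = ((TensorProduct.rid k (A ⊗[k] H)).toLinearMap ∘ₗ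
        LinearMap.lTensor (A ⊗[k] H) WA.counit) ∘ₗ smashCoact WA coact :=
      LinearMap.ext projBar_eq_smashCoact
    rw [h2, LinearMap.lTensor_comp_apply]
    induction u with
    | zero => simp
    | add s t hs ht => simp only [map_add, hs, ht]
    | tmul x h =>
      rw [← assoc_rTensor_smashComul_smashCoact hC, LinearMap.comp_apply]
      induction smashCoact WA coact (x ⊗ₜ[k] h) with
      | zero => simp
      | add s t hs ht => simp only [map_add, hs, ht]
      | tmul y a =>
        simp only [LinearMap.comp_apply, LinearMap.lTensor_tmul, LinearEquiv.coe_coe,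
          TensorProduct.rid_tmul, map_smul, LinearMap.rTensor_tmul]
        induction smashComul k WH WA coact y with
        | zero => simp
        | add s t hs ht => simp only [map_add, TensorProduct.add_tmul, smul_add, hs, ht]
        | tmul v w => simp
  rw [h1, ← LinearMap.lTensor_comp_rTensor, LinearMap.comp_apply, rTensor_projBar_smashComul hC]

end Coaction

end Aux

theorem both_comul
    {k H A : Type*} [Field k] [Ring H] [Algebra k H] [Ring A] [Algebra k A]
    (WH : WeakBialgebra k H) (WA : WeakBialgebra k A)
    (act : H →ₗ[k] A →ₗ[k] A) (coact : H →ₗ[k] H ⊗[k] A)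
    (hCP : IsCompatiblePair k WH WA act coact) :
    (∀ (x : A) (h : H),
        smashComul k WH WA coact (projBoth k WH WA act coact (x ⊗ₜ[k] h)) =
          (TensorProduct.map (projBoth k WH WA act coact) (projBoth k WH WA act coact))
            (smashComul k WH WA coact (x ⊗ₜ[k] h))) ∧
    (∀ (x : A) (h : H),
        smashComul k WH WA coact (projBoth k WH WA act coact (x ⊗ₜ[k] h)) ∈
          LinearMap.range
            (TensorProduct.map (projBoth k WH WA act coact)
              (projBoth k WH WA act coact))) := by
  have key (x : A) (h : H) :
      smashComul k WH WA coact (projBoth k WH WA act coact (x ⊗ₜ[k] h)) =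
        TensorProduct.map (projBoth k WH WA act coact) (projBoth k WH WA act coact)
          (smashComul k WH WA coact (x ⊗ₜ[k] h)) := by
    rw [projBoth, LinearMap.comp_apply, smashComul_projBar hCP.pair.comoduleCoalgebra,
      smashComul_projUnder hCP, ← LinearMap.comp_apply, ← TensorProduct.map_comp]
  exact ⟨key, fun x h ↦ ⟨_, (key x h).symm⟩⟩

end WeakSmash
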